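/- Fix γ ∈ (1/4, 1]. Let (M_t)_{t≥0} be a real-valued martingale with respect to a filtration (F_t)_{t≥0} such that almost surely: (i) t ↦ M_t is continuous and, for every T > 0, there is a (random) finite constant C with |M_t − M_s| ≤ C·|t − s|^γ for all s, t ∈ [0, T]; and (ii) there is a (random) set A ⊆ [0, ∞) such that M is constant on every interval contained in [0, ∞) \ A and, for every T > 0, 2^{−2γk} · #{ j ∈ {1, …, 2^k} : [t_{j−1}^k, t_j^k] ∩ A ≠ ∅ } → 0 as k → ∞. Then almost surely M_t = M_0 for all t ≥ 0. -/

import Mathlib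

open MeasureTheory Filter Topology

lemma aux_f1 (x y : ℝ) : √(1+y^2) - √(1+x^2) ≤ (x/√(1+x^2))*(y-x) + (y-x)^2/2 := by
  set s := √(1+x^2) with hs
  have hs1 : 1 ≤ s := by rw [hs]; apply Real.one_le_sqrt.2; nlinarith [sq_nonneg x]
  have hs2 : s^2 = 1+x^2 := Real.sq_sqrt (by positivity)
  set r := √(1+y^2) with hr
  have hr2 : r^2 = 1+y^2 := Real.sq_sqrt (by positivity)
  have h1 : r - s ≤ (x*(y-x) + (y-x)^2/2)/s := by
    rw [le_div_iff₀ (by linarith)]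
    nlinarith [sq_nonneg (r-s)]
  have h2 : (y-x)^2/2/s ≤ (y-x)^2/2 := div_le_self (by positivity) hs1
  calc r - s ≤ (x*(y-x) + (y-x)^2/2)/s := h1
    _ = x/s*(y-x) + (y-x)^2/2/s := by ring
    _ ≤ _ := by linarith

lemma aux_f2 (x : ℝ) : |x/√(1+x^2)| ≤ 1 := by
  rw [abs_div, abs_of_nonneg (Real.sqrt_nonneg _)]
  apply div_le_one_of_le₀ _ (Real.sqrt_nonneg _)
  apply Real.abs_le_sqrt; linarith

lemma aux_f3 (x y : ℝ) : √(1+y^2) - √(1+x^2) ≤ |y-x| := by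
  have : √(1+y^2) ≤ √(1+x^2) + |y-x| := by
    apply Real.sqrt_le_iff.2
    refine ⟨by positivity, ?_⟩
    have hs2 : √(1+x^2)^2 = 1+x^2 := Real.sq_sqrt (by positivity)
    have h3 : |x| ≤ √(1+x^2) := by apply Real.abs_le_sqrt; linarith
    have h4 : x*(y-x) ≤ |x| * |y-x| := by rw [← abs_mul]; exact le_abs_self _
    have h5 : |x| * |y-x| ≤ √(1+x^2) * |y-x| := by gcongr
    nlinarith [sq_abs (y-x)]
  linarith

lemma aux_f4 (x y : ℝ) : √(1+y^2) - √(1+x^2) ≤ (x/√(1+x^2))*(y-x) + 2*|y-x| := by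
  have h1 := aux_f3 x y
  have h2 : -((x/√(1+x^2))*(y-x)) ≤ 1 * |y-x| := by
    refine (neg_le_abs _).trans ?_
    rw [abs_mul]; gcongr; exact aux_f2 x
  linarith

/-- discrete quadratic variation -/
noncomputable def qv (x : ℕ → ℝ) (n : ℕ) : ℝ := ∑ j ∈ Finset.range n, (x (j+1) - x j)^2

lemma qv_succ (x : ℕ → ℝ) (n : ℕ) : qv x (n+1) = qv x n + (x (n+1) - x n)^2 := by
  simp [qv, Finset.sum_range_succ]

lemma qv_mono (x : ℕ → ℝ) : Monotone (qv x) :=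
  monotone_nat_of_le_succ fun n => by rw [qv_succ]; nlinarith [sq_nonneg (x (n+1) - x n)]

def good (x : ℕ → ℝ) (ε K : ℝ) (n : ℕ) : Prop := ∀ i ≤ n, qv x i ≤ ε ∧ |x i| ≤ K

open Classical in
lemma path1 (x : ℕ → ℝ) (h0 : x 0 = 0) (ε K : ℝ) (n : ℕ) :
    (if good x ε K n then √(1+(x n)^2) - 1 else 0) ≤
      ∑ j ∈ Finset.range n, if good x ε K j then √(1+(x (j+1))^2) - √(1+(x j)^2) else 0 := by
  have key : 0 ≤ (∑ j ∈ Finset.range n, if good x ε K j then √(1+(x (j+1))^2) - √(1+(x j)^2) else 0) ∧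
    (good x ε K n → (∑ j ∈ Finset.range n, if good x ε K j then √(1+(x (j+1))^2) - √(1+(x j)^2) else 0) = √(1+(x n)^2) - 1) := by
    induction n with
    | zero => simp [h0]
    | succ n ih =>
      have h1 : good x ε K (n+1) → good x ε K n := fun h i hi => h i (by omega)
      have h2 : 1 ≤ √(1+(x (n+1))^2) := Real.one_le_sqrt.2 (by nlinarith [sq_nonneg (x (n+1))])
      rw [Finset.sum_range_succ]
      by_cases hg : good x ε K n
      · rw [ih.2 hg]; simp only [hg, if_true]
        exact ⟨by linarith, fun _ => by ring⟩
      · simp only [hg, if_false, add_zero]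
        exact ⟨ih.1, fun h => absurd (h1 h) hg⟩
  split_ifs with h
  · exact (key.2 h).ge
  · exact key.1

open Classical in
lemma path2 (x : ℕ → ℝ) (ε K : ℝ) (hε : 0 ≤ ε) (n : ℕ) :
    (∑ j ∈ Finset.range n, if good x ε K j ∧ qv x (j+1) ≤ ε then (x (j+1) - x j)^2 else 0) ≤ ε := by
  suffices h : (∑ j ∈ Finset.range n, if good x ε K j ∧ qv x (j+1) ≤ ε then (x (j+1) - x j)^2 else 0) ≤ min (qv x n) ε from h.trans (min_le_right _ _)
  induction n with
  | zero => simp [qv, hε]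
  | succ n ih =>
    rw [Finset.sum_range_succ]
    have h1 := qv_succ x n
    have h2 := sq_nonneg (x (n+1) - x n)
    rw [le_min_iff] at ih ⊢
    split_ifs with h
    · constructor <;> linarith [h.2]
    · constructor <;> linarith

open Classical in
lemma path3 (x : ℕ → ℝ) (ε K : ℝ) (n : ℕ) :
    (∑ j ∈ Finset.range n, if good x ε K j ∧ ε < qv x (j+1) then (1:ℝ) else 0) ≤ 
      if ε < qv x n then 1 else 0 := by
  induction n with
  | zero => simp; split_ifs <;> norm_num
  | succ n ih =>
    rw [Finset.sum_range_succ]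
    have h1 := qv_mono x (Nat.le_succ n)
    by_cases hg : good x ε K n
    · have h2 : ¬ ε < qv x n := not_lt.2 (hg n le_rfl).1
      rw [if_neg h2] at ih
      simp only [hg, true_and]
      linarith
    · simp only [hg, false_and, if_false, add_zero]
      refine ih.trans ?_
      split_ifs with h2 h3 h3
      · rfl
      · exact absurd (h2.trans_le h1) h3
      · norm_num
      · rfl

open Classical in
lemma path4 (x : ℕ → ℝ) (ε K : ℝ) (j : ℕ) :
    (if good x ε K j then √(1+(x (j+1))^2) - √(1+(x j)^2) else 0) ≤ 
     (if good x ε K j then x j / √(1+(x j)^2) else 0) * (x (j+1) - x j) + 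
     (if good x ε K j ∧ qv x (j+1) ≤ ε then (x (j+1) - x j)^2 else 0)/2 +
     2 * (if good x ε K j ∧ ε < qv x (j+1) then K + |x (j+1)| else 0) := by
  by_cases hg : good x ε K j
  · by_cases hq : ε < qv x (j+1)
    · have h1 := aux_f4 (x j) (x (j+1))
      have h2 := (hg j le_rfl).2
      have h3 := abs_sub (x (j+1)) (x j)
      simp only [hg, hq, not_le.2 hq, and_true, and_false, if_true, if_false]
      linarith
    · have h1 := aux_f1 (x j) (x (j+1))
      simp only [hg, hq, not_lt.1 hq, and_true, and_false, if_true, if_false]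
      linarith
  · simp [hg]

section disc
variable {Ω : Type*} [m0 : MeasurableSpace Ω] (P : Measure Ω) [IsProbabilityMeasure P]

lemma qv_meas (m : MeasurableSpace Ω) (X : ℕ → Ω → ℝ) (n : ℕ)
    (h : ∀ i ≤ n, Measurable[m] (X i)) : Measurable[m] (fun ω => qv (fun i => X i ω) n) := by
  unfold qv
  refine Finset.measurable_fun_sum _ fun i hi => ?_
  have := Finset.mem_range.1 hi
  exact ((h (i+1) (by omega)).sub (h i (by omega))).pow_const 2

lemma good_meas (m : MeasurableSpace Ω) (X : ℕ → Ω → ℝ) (ε K : ℝ) (n : ℕ)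
    (h : ∀ i ≤ n, Measurable[m] (X i)) : MeasurableSet[m] {ω | good (fun i => X i ω) ε K n} := by
  have : {ω | good (fun i => X i ω) ε K n} = ⋂ i, ⋂ (_ : i ≤ n), ({ω | qv (fun i => X i ω) i ≤ ε} ∩ {ω | |X i ω| ≤ K}) := by
    ext ω; simp [good]
  rw [this]
  refine MeasurableSet.iInter fun i => MeasurableSet.iInter fun hi => ?_
  refine MeasurableSet.inter ?_ ?_
  · exact measurableSet_le (qv_meas m X i fun j hj => h j (hj.trans hi)) measurable_const
  · exact measurableSet_le ((h i hi).abs) measurable_const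

lemma abs_submart (X : ℕ → Ω → ℝ) (𝒢 : Filtration ℕ m0) (hX : Martingale X 𝒢 P) {i j : ℕ}
    (hij : i ≤ j) {s : Set Ω} (hs : MeasurableSet[𝒢 i] s) :
    ∫ ω in s, |X i ω| ∂P ≤ ∫ ω in s, |X j ω| ∂P :=
  (hX.submartingale.sup hX.neg.submartingale).setIntegral_le hij hs

lemma incr_zero (X : ℕ → Ω → ℝ) (𝒢 : Filtration ℕ m0) (hX : Martingale X 𝒢 P) (j : ℕ)
    (g : Ω → ℝ) (hg : Measurable[𝒢 j] g) (hb : ∀ ω, |g ω| ≤ 1) :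
    Integrable (fun ω => g ω * (X (j+1) ω - X j ω)) P ∧ ∫ ω, g ω * (X (j+1) ω - X j ω) ∂P = 0 := by
  have hd : Integrable (X (j+1) - X j) P := (hX.integrable _).sub (hX.integrable _)
  constructor
  · exact hd.bdd_mul (hg.mono (𝒢.le j) le_rfl).aestronglyMeasurable (c := 1) (.of_forall hb)
  · have h1 := condExp_stronglyMeasurable_mul_of_bound (𝒢.le j) hg.stronglyMeasurable hd 1 (.of_forall hb)
    have h2 : P[X (j+1) - X j | 𝒢 j] =ᵐ[P] 0 := by
      refine (condExp_sub (hX.integrable _) (hX.integrable _) _).trans ?_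
      filter_upwards [hX.condExp_ae_eq (Nat.le_succ j), hX.condExp_ae_eq (le_refl j)] with ω ha hb
      simp only [Nat.succ_eq_add_one] at ha
      simp [ha, hb]
    have h3 := integral_condExp (μ := P) (f := g * (X (j+1) - X j)) (𝒢.le j)
    have h4 : ∫ ω, (g * (X (j+1) - X j)) ω ∂P = 0 := by
      rw [← h3]
      rw [integral_congr_ae (g := fun _ => (0:ℝ))]
      · simp
      · filter_upwards [h1, h2] with ω ha hb
        rw [ha]; simp [hb]
    exact h4

open Classical in
lemma disc_ineq (X : ℕ → Ω → ℝ) (𝒢 : Filtration ℕ m0) (hX : Martingale X 𝒢 P)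
    (h0 : ∀ ω, X 0 ω = 0) (ε K : ℝ) (hε : 0 ≤ ε) (hK : 0 ≤ K) (N : ℕ) (G : Set Ω)
    (hGm : MeasurableSet G) (hG : ∀ ω ∈ G, ∀ i ≤ N, |X i ω| ≤ K) :
    ∫ ω in G, (√(1+(X N ω)^2) - 1) ∂P ≤
      ε/2 + 3 * ∫ ω in {ω | ε < qv (fun i => X i ω) N}, (K + |X N ω|) ∂P := by
  have hm : ∀ {i j : ℕ}, i ≤ j → Measurable[𝒢 j] (X i) := fun {i j} hij =>
    ((hX.stronglyAdapted i).measurable).mono (𝒢.mono hij) le_rfl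
  have hm0 : ∀ i, Measurable (X i) := fun i => (hm le_rfl).mono (𝒢.le i) le_rfl
  set B : ℕ → Set Ω := fun j => {ω | good (fun i => X i ω) ε K j ∧ ε < qv (fun i => X i ω) (j+1)} with hB
  set g : ℕ → Ω → ℝ := fun j ω => if good (fun i => X i ω) ε K j then X j ω / √(1+(X j ω)^2) else 0 with hgdef
  set S : Set Ω := {ω | ε < qv (fun i => X i ω) N} with hS
  have hgm : ∀ j, Measurable[𝒢 j] (g j) := fun j =>
    Measurable.ite (good_meas (𝒢 j) X ε K j fun i hi => hm hi)
      ((hm le_rfl).div (((hm le_rfl).pow_const 2).const_add 1).sqrt) measurable_const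
  have hgb : ∀ j ω, |g j ω| ≤ 1 := by
    intro j ω
    simp only [hgdef]
    split_ifs
    · exact aux_f2 _
    · simp
  have hBm : ∀ j, MeasurableSet[𝒢 (j+1)] (B j) := fun j =>
    MeasurableSet.inter (good_meas (𝒢 (j+1)) X ε K j fun i hi => hm (by omega))
      (measurableSet_lt measurable_const (qv_meas _ X (j+1) fun i hi => hm hi))
  have hBm0 : ∀ j, MeasurableSet (B j) := fun j => 𝒢.le _ _ (hBm j)
  have hSm : MeasurableSet S := measurableSet_lt measurable_const (qv_meas _ X N fun i _ => hm0 i)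
  have hKi : ∀ i, Integrable (fun ω => K + |X i ω|) P := fun i =>
    (integrable_const K).add (hX.integrable i).abs
  have hfi : Integrable (fun ω => √(1+(X N ω)^2) - 1) P := by
    refine (hX.integrable N).abs.mono' ?_ (.of_forall fun ω => ?_)
    · exact ((((hm0 N).pow_const 2).const_add 1).sqrt.sub_const 1).aestronglyMeasurable
    · have h1 := aux_f3 0 (X N ω)
      have h2 : 1 ≤ √(1+(X N ω)^2) := Real.one_le_sqrt.2 (by nlinarith [sq_nonneg (X N ω)])
      rw [Real.norm_eq_abs, abs_of_nonneg (by linarith)]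
      simpa using h1
  -- pathwise
  have hpw : ∀ ω, G.indicator (fun ω => √(1+(X N ω)^2) - 1) ω ≤
      ∑ j ∈ Finset.range N, g j ω * (X (j+1) ω - X j ω) + ε/2 +
      2 * ∑ j ∈ Finset.range N, (B j).indicator (fun ω => K + |X (j+1) ω|) ω
      + S.indicator (fun ω => K + |X N ω|) ω := by
    intro ω
    have p1 := path1 (fun i => X i ω) (h0 ω) ε K N
    have p2 := path2 (fun i => X i ω) ε K hε N
    have p4 := Finset.sum_le_sum fun j (_ : j ∈ Finset.range N) => path4 (fun i => X i ω) ε K j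
    rw [Finset.sum_add_distrib, Finset.sum_add_distrib, ← Finset.mul_sum, ← Finset.sum_div] at p4
    have e1 : ∀ j, (B j).indicator (fun ω => K + |X (j+1) ω|) ω = 
      if good (fun i => X i ω) ε K j ∧ ε < qv (fun i => X i ω) (j+1) then K + |X (j+1) ω| else 0 := by
      intro j; simp [hB, Set.indicator_apply]
    simp only [e1]
    have h2 : 1 ≤ √(1+(X N ω)^2) := Real.one_le_sqrt.2 (by nlinarith [sq_nonneg (X N ω)])
    have h3 : G.indicator (fun ω => √(1+(X N ω)^2) - 1) ω ≤ 
      (if good (fun i => X i ω) ε K N then √(1+(X N ω)^2) - 1 else 0) + S.indicator (fun ω => K + |X N ω|) ω := by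
      have h4 : 0 ≤ S.indicator (fun ω => K + |X N ω|) ω :=
        Set.indicator_nonneg (fun _ _ => by positivity) _
      by_cases hω : ω ∈ G
      · rw [Set.indicator_of_mem hω]
        by_cases hs : ω ∈ S
        · rw [Set.indicator_of_mem hs]
          have := aux_f3 0 (X N ω)
          simp only [ne_eq, OfNat.ofNat_ne_zero, not_false_eq_true, zero_pow, add_zero, Real.sqrt_one, sub_zero] at this
          split_ifs
          · have : 0 ≤ K + |X N ω| := by positivity
            linarith
          · linarith
        · have : good (fun i => X i ω) ε K N := fun i hi =>
            ⟨(qv_mono _ hi).trans (not_lt.1 hs), hG ω hω i hi⟩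
          rw [if_pos this]; linarith
      · rw [Set.indicator_of_notMem hω]
        split_ifs <;> linarith
    simp only [hgdef]
    linarith
  have i1 : Integrable (fun ω => ∑ j ∈ Finset.range N, g j ω * (X (j+1) ω - X j ω)) P :=
    integrable_finsetSum _ fun j _ => (incr_zero P X 𝒢 hX j (g j) (hgm j) (hgb j)).1
  have i2 : Integrable (fun ω => ∑ j ∈ Finset.range N, (B j).indicator (fun ω => K + |X (j+1) ω|) ω) P :=
    integrable_finsetSum _ fun j _ => (hKi _).indicator (hBm0 j)
  have i3 : Integrable (S.indicator (fun ω => K + |X N ω|)) P := (hKi _).indicator hSm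
  have hint := integral_mono (hfi.indicator hGm) (((i1.add (integrable_const (ε/2))).add (i2.const_mul 2)).add i3) hpw
  rw [integral_add' ((i1.add (integrable_const (ε/2))).add (i2.const_mul 2)) i3,
    integral_add' (i1.add (integrable_const (ε/2))) (i2.const_mul 2),
    integral_add' i1 (integrable_const (ε/2)), integral_const_mul,
    integral_indicator hGm, integral_indicator hSm, 
    integral_finsetSum _ (fun j _ => (incr_zero P X 𝒢 hX j (g j) (hgm j) (hgb j)).1),
    Finset.sum_eq_zero (fun j _ => (incr_zero P X 𝒢 hX j (g j) (hgm j) (hgb j)).2)] at hint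
  have hlast : ∫ ω, ∑ j ∈ Finset.range N, (B j).indicator (fun ω => K + |X (j+1) ω|) ω ∂P ≤ 
      ∫ ω in S, (K + |X N ω|) ∂P := by
    rw [integral_finsetSum _ (fun j _ => (hKi _).indicator (hBm0 j))]
    calc _ ≤ ∑ j ∈ Finset.range N, ∫ ω, (B j).indicator (fun ω => K + |X N ω|) ω ∂P := by
          refine Finset.sum_le_sum fun j hj => ?_
          rw [integral_indicator (hBm0 j), integral_indicator (hBm0 j), 
            integral_add (integrable_const K) (hX.integrable _).abs.integrableOn,
            integral_add (integrable_const K) (hX.integrable _).abs.integrableOn]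
          have := abs_submart P X 𝒢 hX (Nat.succ_le_of_lt (Finset.mem_range.1 hj)) (hBm j)
          simpa using this
      _ = ∫ ω, ∑ j ∈ Finset.range N, (B j).indicator (fun ω => K + |X N ω|) ω ∂P := by
          rw [integral_finsetSum _ (fun j _ => (hKi _).indicator (hBm0 j))]
      _ ≤ ∫ ω, S.indicator (fun ω => K + |X N ω|) ω ∂P := by
          refine integral_mono (integrable_finsetSum _ fun j _ => (hKi _).indicator (hBm0 j)) i3 fun ω => ?_
          have p3 := path3 (fun i => X i ω) ε K N
          have hn : 0 ≤ K + |X N ω| := by positivity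
          have := mul_le_mul_of_nonneg_right p3 hn
          rw [Finset.sum_mul] at this
          simp only [ite_mul, one_mul, zero_mul] at this
          simp only [Set.indicator_apply]
          exact this
      _ = _ := integral_indicator hSm
  have hc : ∫ _ω, ε/2 ∂P = ε/2 := by simp
  linarith
end disc

/-- grid point -/
noncomputable def gp (T : ℝ) (k j : ℕ) : ℝ := (j : ℝ) * 2 ^ (-(k : ℝ)) * T

lemma gp_nonneg {T : ℝ} (hT : 0 < T) (k j : ℕ) : 0 ≤ gp T k j := by unfold gp; positivity

lemma gp_mono {T : ℝ} (hT : 0 < T) (k : ℕ) : Monotone (gp T k) := by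
  intro i j h; unfold gp; gcongr

lemma gp_last (T : ℝ) (k : ℕ) : gp T k (2^k) = T := by
  unfold gp
  have : (2:ℝ) ^ (-(k : ℝ)) = (2^k)⁻¹ := by rw [Real.rpow_neg (by norm_num), Real.rpow_natCast]
  rw [this]; push_cast; field_simp

lemma gp_le {T : ℝ} (hT : 0 < T) {k j : ℕ} (h : j ≤ 2^k) : gp T k j ≤ T :=
  (gp_mono hT k h).trans (gp_last T k).le

lemma path_qv (γ : ℝ) (m : ℝ → ℝ) (T : ℝ) (hT : 0 < T) (A : Set ℝ) (C : ℝ)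
    (hC : ∀ s ∈ Set.Icc 0 T, ∀ t ∈ Set.Icc 0 T, |m t - m s| ≤ C * |t - s| ^ γ)
    (hA : ∀ I : Set ℝ, I.OrdConnected → I ⊆ Set.Ici 0 \ A → ∀ x ∈ I, ∀ y ∈ I, m x = m y)
    (hlim : Tendsto
            (fun k : ℕ => (2 : ℝ) ^ (-(2 * γ) * k) *
              ({j : ℕ | 1 ≤ j ∧ j ≤ 2 ^ k ∧
                (Set.Icc (((j : ℝ) - 1) * 2 ^ (-(k : ℝ)) * T) ((j : ℝ) * 2 ^ (-(k : ℝ)) * T)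
                  ∩ A).Nonempty}.ncard : ℝ))
            atTop (𝓝 0)) :
    Tendsto (fun k : ℕ => qv (fun i => m (gp T k i) - m 0) (2^k)) atTop (𝓝 0) := by
  classical
  have hlim2 := hlim.const_mul (C^2 * (T^γ)^2)
  rw [mul_zero] at hlim2
  refine squeeze_zero (fun k => Finset.sum_nonneg fun _ _ => sq_nonneg _) (fun k => ?_) hlim2
  set S := {j : ℕ | 1 ≤ j ∧ j ≤ 2 ^ k ∧
                (Set.Icc (((j : ℝ) - 1) * 2 ^ (-(k : ℝ)) * T) ((j : ℝ) * 2 ^ (-(k : ℝ)) * T)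
                  ∩ A).Nonempty} with hS
  have hSf : S.Finite := (Set.finite_le_nat (2^k)).subset fun j hj => hj.2.1
  set D := C^2 * (T^γ)^2 * (2:ℝ)^(-(2*γ)*k) with hD
  have hD0 : 0 ≤ D := by positivity
  have hterm : ∀ i ∈ Finset.range (2^k), ((m (gp T k (i+1)) - m 0) - (m (gp T k i) - m 0))^2 ≤
      if i + 1 ∈ S then D else 0 := by
    intro i hi
    have hi' := Finset.mem_range.1 hi
    rw [sub_sub_sub_cancel_right]
    split_ifs with h
    · have h1 := hC (gp T k i) ⟨gp_nonneg hT _ _, gp_le hT hi'.le⟩ (gp T k (i+1)) ⟨gp_nonneg hT _ _, gp_le hT hi'⟩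
      have h2 : gp T k (i+1) - gp T k i = 2^(-(k:ℝ)) * T := by unfold gp; push_cast; ring
      have h2' : (0:ℝ) ≤ 2^(-(k:ℝ)) * T := by positivity
      rw [h2, abs_of_nonneg h2'] at h1
      have h3 := pow_le_pow_left₀ (abs_nonneg _) h1 2
      rw [sq_abs] at h3
      refine h3.trans (le_of_eq ?_)
      rw [Real.mul_rpow (by positivity) hT.le, ← Real.rpow_mul (by norm_num)]
      have h4 : (2:ℝ)^(-(2*γ)*k) = ((2:ℝ)^(-(k:ℝ)*γ))^2 := by
        rw [← Real.rpow_natCast, ← Real.rpow_mul (by norm_num)]; congr 1; push_cast; ring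
      rw [hD, h4]; ring
    · have h1 : ¬ (Set.Icc (gp T k i) (gp T k (i+1)) ∩ A).Nonempty := by
        intro h2
        refine h ⟨by omega, hi', ?_⟩
        unfold gp at h2
        push_cast at h2 ⊢
        simpa using h2
      have hle := gp_mono hT k (Nat.le_succ i)
      have h2 := hA (Set.Icc (gp T k i) (gp T k (i+1))) Set.ordConnected_Icc
        (fun x hx => ⟨(gp_nonneg hT k i).trans hx.1, fun hxA => h1 ⟨x, hx, hxA⟩⟩)
        (gp T k (i+1)) ⟨hle, le_rfl⟩ (gp T k i) ⟨le_rfl, hle⟩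
      rw [h2]; simp
  refine (Finset.sum_le_sum hterm).trans ?_
  rw [← Finset.sum_filter, Finset.sum_const, nsmul_eq_mul, ← mul_assoc (C^2 * (T^γ)^2), ← hD, mul_comm]
  gcongr
  rw [← Set.ncard_coe_finset]
  refine Set.ncard_le_ncard_of_injOn (fun i => i+1) ?_ (fun a _ b _ h => by simpa using h) hSf
  intro i hi
  simpa using (Finset.mem_filter.1 hi).2

/-- Fix `γ ∈ (1/4, 1]`.  Let `(M_t)_{t≥0}` be a real-valued martingale with
respect to a filtration `(F_t)_{t≥0}` such that almost surely: (i) `t ↦ M_t` is continuous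
and locally `γ`-Hölder on `[0, ∞)`; and (ii) there is a (random) set `A ⊆ [0, ∞)` such that
`M` is constant on every interval contained in `[0, ∞) \ A` and, for every `T > 0`,
`2^(−2γk) · #{j ∈ {1,…,2^k} : [t_{j−1}^k, t_j^k] ∩ A ≠ ∅} → 0` as `k → ∞`, where
`t_j^k = j·2^(−k)·T`.  Then almost surely `M_t = M_0` for all `t ≥ 0`. -/
theorem stmt_6
    {Ω : Type*} [MeasurableSpace Ω] (P : Measure Ω) [IsProbabilityMeasure P]
    (γ : ℝ) (hγ : γ ∈ Set.Ioc (1 / 4 : ℝ) 1)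
    (F : ℝ → MeasurableSpace Ω)
    (hFmono : ∀ s t : ℝ, 0 ≤ s → s ≤ t → F s ≤ F t)
    (hFle : ∀ t : ℝ, 0 ≤ t → F t ≤ (inferInstance : MeasurableSpace Ω))
    (M : ℝ → Ω → ℝ)
    (hMint : ∀ t : ℝ, 0 ≤ t → Integrable (M t) P)
    (hMadapted : ∀ t : ℝ, 0 ≤ t → Measurable[F t] (M t))
    (hmart : ∀ t₁ t₂ : ℝ, 0 ≤ t₁ → t₁ ≤ t₂ → (P[(M t₂) | (F t₁)]) =ᵐ[P] M t₁)
    (hpath : ∀ᵐ ω ∂P,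
      -- (i) continuity and local `γ`-Hölder continuity on `[0, ∞)`
      ContinuousOn (fun t => M t ω) (Set.Ici 0) ∧
      (∀ T > (0 : ℝ), ∃ C : ℝ, ∀ s ∈ Set.Icc 0 T, ∀ t ∈ Set.Icc 0 T,
        |M t ω - M s ω| ≤ C * |t - s| ^ γ) ∧
      -- (ii) a set `A ⊆ [0, ∞)` off which `M` is locally constant, hitting few dyadic
      -- intervals
      (∃ A : Set ℝ, A ⊆ Set.Ici 0 ∧
        (∀ I : Set ℝ, I.OrdConnected → I ⊆ Set.Ici 0 \ A →
          ∀ x ∈ I, ∀ y ∈ I, M x ω = M y ω) ∧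
        (∀ T > (0 : ℝ),
          Tendsto
            (fun k : ℕ => (2 : ℝ) ^ (-(2 * γ) * k) *
              ({j : ℕ | 1 ≤ j ∧ j ≤ 2 ^ k ∧
                (Set.Icc (((j : ℝ) - 1) * 2 ^ (-(k : ℝ)) * T) ((j : ℝ) * 2 ^ (-(k : ℝ)) * T)
                  ∩ A).Nonempty}.ncard : ℝ))
            atTop (𝓝 0)))) :
    ∀ᵐ ω ∂P, ∀ t : ℝ, 0 ≤ t → M t ω = M 0 ω := by
  have main : ∀ T : ℝ, 0 < T → ∀ᵐ ω ∂P, M T ω = M 0 ω := by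
    intro T hT
    have hM0 : ∀ t, 0 ≤ t → Measurable (M t) := fun t ht => (hMadapted t ht).mono (hFle t ht) le_rfl
    let X : ℕ → ℕ → Ω → ℝ := fun k i ω => M (gp T k i) ω - M 0 ω
    let 𝒢 : ℕ → Filtration ℕ (inferInstance : MeasurableSpace Ω) := fun k =>
      ⟨fun i => F (gp T k i), fun i j h => hFmono _ _ (gp_nonneg hT k i) (gp_mono hT k h),
        fun i => hFle _ (gp_nonneg hT k i)⟩
    have hXm : ∀ k i, Measurable (X k i) := fun k i => (hM0 _ (gp_nonneg hT k i)).sub (hM0 0 le_rfl)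
    have hX : ∀ k, Martingale (X k) (𝒢 k) P := by
      intro k
      have hz : ∀ i, Measurable[F (gp T k i)] (M 0) := fun i =>
        (hMadapted 0 le_rfl).mono (hFmono _ _ le_rfl (gp_nonneg hT k i)) le_rfl
      refine ⟨fun i => ?_, fun i j hij => ?_⟩
      · exact ((hMadapted _ (gp_nonneg hT k i)).sub (hz i)).stronglyMeasurable
      · refine (condExp_sub (hMint _ (gp_nonneg hT k j)) (hMint 0 le_rfl) _).trans ?_
        have h1 := condExp_of_stronglyMeasurable (μ := P) (hFle _ (gp_nonneg hT k i)) (hz i).stronglyMeasurable (hMint 0 le_rfl)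
        have h2 := hmart _ _ (gp_nonneg hT k i) (gp_mono hT k hij)
        filter_upwards [h2] with ω h2
        change (P[M (gp T k j) | F (gp T k i)]) ω - (P[M 0 | F (gp T k i)]) ω = _
        rw [h1, h2]
    have hX0 : ∀ k ω, X k 0 ω = 0 := by intro k ω; simp [X, gp]
    have hXT : ∀ k ω, X k (2^k) ω = M T ω - M 0 ω := by intro k ω; simp only [X, gp_last]
    let G : ℕ → Set Ω := fun K => {ω | ∀ k : ℕ, ∀ i ≤ 2^k, |X k i ω| ≤ K}
    have hGm : ∀ K, MeasurableSet (G K) := by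
      intro K
      have : G K = ⋂ k : ℕ, ⋂ i : ℕ, ⋂ (_ : i ≤ 2^k), {ω | |X k i ω| ≤ K} := by
        ext ω; simp [G]
      rw [this]
      exact MeasurableSet.iInter fun k => MeasurableSet.iInter fun i => MeasurableSet.iInter fun _ =>
        measurableSet_le (hXm k i).abs measurable_const
    have hqv : ∀ᵐ ω ∂P, Tendsto (fun k : ℕ => qv (fun i => X k i ω) (2^k)) atTop (𝓝 0) := by
      filter_upwards [hpath] with ω ⟨_, h2, A, _, h4, h5⟩
      obtain ⟨C, hC⟩ := h2 T hT
      exact path_qv γ (fun t => M t ω) T hT A C hC h4 (h5 T hT)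
    have hI : Integrable (fun ω => M T ω - M 0 ω) P := (hMint T hT.le).sub (hMint 0 le_rfl)
    have hm : Measurable (fun ω => M T ω - M 0 ω) := (hM0 T hT.le).sub (hM0 0 le_rfl)
    have hfnn : ∀ x : ℝ, 0 ≤ √(1+x^2) - 1 := fun x => by
      have : 1 ≤ √(1+x^2) := Real.one_le_sqrt.2 (by nlinarith [sq_nonneg x])
      linarith
    have hfi : Integrable (fun ω => √(1+(M T ω - M 0 ω)^2) - 1) P := by
      refine hI.abs.mono' ?_ (.of_forall fun ω => ?_)
      · exact (((hm.pow_const 2).const_add 1).sqrt.sub_const 1).aestronglyMeasurable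
      · have h1 := aux_f3 0 (M T ω - M 0 ω)
        rw [Real.norm_eq_abs, abs_of_nonneg (hfnn _)]
        simpa using h1
    have hzero : ∀ K : ℕ, ∀ᵐ ω ∂P, ω ∈ G K → M T ω = M 0 ω := by
      intro K
      have hle : ∀ ε > 0, ∫ ω in G K, (√(1+(M T ω - M 0 ω)^2) - 1) ∂P ≤ ε := by
        intro ε hε
        let S : ℕ → Set Ω := fun k => {ω | ε < qv (fun i => X k i ω) (2^k)}
        have hSm : ∀ k, MeasurableSet (S k) := fun k =>
          measurableSet_lt measurable_const (qv_meas _ (X k) (2^k) fun i _ => hXm k i)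
        have hKi : Integrable (fun ω => (K:ℝ) + |M T ω - M 0 ω|) P := (integrable_const _).add hI.abs
        have hlim : Tendsto (fun k => ∫ ω in S k, ((K:ℝ) + |M T ω - M 0 ω|) ∂P) atTop (𝓝 0) := by
          have : Tendsto (fun k => ∫ ω, (S k).indicator (fun ω => (K:ℝ) + |M T ω - M 0 ω|) ω ∂P) atTop (𝓝 (∫ _ω, (0:ℝ) ∂P)) := by
            refine tendsto_integral_of_dominated_convergence _ (fun k => (hKi.indicator (hSm k)).aestronglyMeasurable) hKi.norm
              (fun k => .of_forall fun ω => norm_indicator_le_norm_self _ _) ?_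
            filter_upwards [hqv] with ω hω
            refine tendsto_const_nhds.congr' ?_
            filter_upwards [hω.eventually (gt_mem_nhds hε)] with k hk
            rw [Set.indicator_of_notMem]
            exact fun h => lt_asymm hk h
          simpa only [integral_indicator (hSm _), integral_zero] using this
        have hb : ∀ k, ∫ ω in G K, (√(1+(M T ω - M 0 ω)^2) - 1) ∂P ≤ 
            ε/2 + 3 * ∫ ω in S k, ((K:ℝ) + |M T ω - M 0 ω|) ∂P := by
          intro k
          have := disc_ineq P (X k) (𝒢 k) (hX k) (hX0 k) ε K hε.le (Nat.cast_nonneg K) (2^k) (G K) (hGm K)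
            (fun ω hω i hi => hω k i hi)
          simp only [hXT] at this
          exact this
        have := ge_of_tendsto' ((hlim.const_mul 3).const_add (ε/2)) hb
        linarith
      have h0 : ∫ ω in G K, (√(1+(M T ω - M 0 ω)^2) - 1) ∂P = 0 :=
        le_antisymm (le_of_forall_pos_le_add fun ε hε => by simpa using hle ε hε)
          (integral_nonneg fun ω => hfnn _)
      rw [integral_eq_zero_iff_of_nonneg (fun ω => hfnn _) hfi.integrableOn] at h0
      have h1 := (ae_restrict_iff' (hGm K)).1 h0
      filter_upwards [h1] with ω h hω
      have h2 : √(1+(M T ω - M 0 ω)^2) = 1 := by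
        have := h hω
        simp only [Pi.zero_apply] at this
        linarith
      rw [Real.sqrt_eq_one] at h2
      have : (M T ω - M 0 ω)^2 = 0 := by linarith
      exact sub_eq_zero.1 (pow_eq_zero_iff (by norm_num) |>.1 this)
    filter_upwards [ae_all_iff.2 hzero, hpath] with ω h1 h2
    obtain ⟨C, hC⟩ := isCompact_Icc.exists_bound_of_continuousOn
      ((h2.1.mono (Set.Icc_subset_Ici_self : Set.Icc 0 T ⊆ Set.Ici 0)).sub continuousOn_const (g := fun _ => M 0 ω))
    obtain ⟨K, hK⟩ := exists_nat_ge C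
    exact h1 K fun k i hi => (hC (gp T k i) ⟨gp_nonneg hT k i, gp_le hT hi⟩).trans hK
  have hall : ∀ᵐ ω ∂P, ∀ q : ℚ, 0 < (q:ℝ) → M q ω = M 0 ω := by
    rw [ae_all_iff]; intro q
    by_cases hq : 0 < (q:ℝ)
    · filter_upwards [main q hq] with ω h _ using h
    · exact .of_forall fun ω h => absurd h hq
  filter_upwards [hall, hpath] with ω h1 h2 t ht
  have hcont := h2.1 t ht
  have hev : ∃ u : ℕ → ℚ, (∀ n, t < u n) ∧ Tendsto (fun n => (u n : ℝ)) atTop (𝓝 t) := by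
    have : ∀ n : ℕ, ∃ q : ℚ, t < q ∧ (q:ℝ) < t + 1/((n:ℝ)+1) := fun n =>
      exists_rat_btwn (by have : (0:ℝ) < 1/((n:ℝ)+1) := by positivity
                          linarith)
    choose u hu1 hu2 using this
    refine ⟨u, hu1, tendsto_of_tendsto_of_tendsto_of_le_of_le tendsto_const_nhds ?_ (fun n => (hu1 n).le) (fun n => (hu2 n).le)⟩
    simpa using (tendsto_one_div_add_atTop_nhds_zero_nat (𝕜 := ℝ)).const_add t
  obtain ⟨u, hu1, hu2⟩ := hev
  have h3 : Tendsto (fun n => (u n : ℝ)) atTop (𝓝[Set.Ici 0] t) :=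
    tendsto_nhdsWithin_iff.2 ⟨hu2, .of_forall fun n => ht.trans (hu1 n).le⟩
  have h4 := hcont.tendsto.comp h3
  refine tendsto_nhds_unique h4 (tendsto_const_nhds.congr fun n => ?_)
  exact (h1 (u n) (ht.trans_lt (hu1 n))).symm
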